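/- arXiv:2109.01308 — 2 statements merged into one kernel-verified Lean document; each statement's English description precedes it below -/
import Mathlib

section
/- Let m ≥ 2 experts forecast an event with n = 2 outcomes, and let α be a real number with α < 0 or α ≥ 4(m−1)². Then the contract function Π^α defined by Π^α_i(P; j) = s_qu(p_i; j) − (m−1)² s_qu(p̄_{−i}; j) + α p̄_{−i,j} is strictly proper and arbitrage-free. -/
open Finset

/-- Brier's quadratic scoring rule: `s_qu(p; j) = 1 - (1 - p j)^2 - ∑_{l ≠ j} (p l)^2`. -/
noncomputable def squ {n : ℕ} (p : Fin n → ℝ) (j : Fin n) : ℝ :=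
  1 - (1 - p j) ^ 2 - ∑ l ∈ ({j}ᶜ : Finset (Fin n)), (p l) ^ 2

/-- The average report `p̄_{-i}` of all experts except `i`. -/
noncomputable def avgExcept {m n : ℕ} (P : Fin m → Fin n → ℝ) (i : Fin m) : Fin n → ℝ :=
  fun j => (1 / ((m : ℝ) - 1)) * ∑ k ∈ ({i}ᶜ : Finset (Fin m)), P k j

/-- The contract function `Π^α_i(P; j) = s_qu(p_i; j) - (m-1)^2 s_qu(p̄_{-i}; j) + α p̄_{-i,j}`. -/
noncomputable def piAlpha {m n : ℕ} (α : ℝ) (P : Fin m → Fin n → ℝ) (i : Fin m) (j : Fin n) : ℝ :=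
  squ (P i) j - ((m : ℝ) - 1) ^ 2 * squ (avgExcept P i) j + α * avgExcept P i j

/-- A tuple of reports, one probability distribution in the simplex `Δ_n` per expert. -/
def IsSimplexTuple {m n : ℕ} (P : Fin m → Fin n → ℝ) : Prop :=
  ∀ k, P k ∈ stdSimplex ℝ (Fin n)

/-- A contract function is strictly proper if, for every expert `i`, belief `b ∈ Δ_n`, and
fixed reports of the other experts, the expected reward `∑ j, b j * Π_i(x, p_{-i}; j)` is
uniquely maximized over `x ∈ Δ_n` at `x = b`. -/
def StrictlyProper {m n : ℕ} (Φ : (Fin m → Fin n → ℝ) → Fin m → Fin n → ℝ) : Prop :=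
  ∀ (i : Fin m) (P : Fin m → Fin n → ℝ), IsSimplexTuple P →
    ∀ b ∈ stdSimplex ℝ (Fin n), ∀ x ∈ stdSimplex ℝ (Fin n), x ≠ b →
      ∑ j, b j * Φ (Function.update P i x) i j < ∑ j, b j * Φ (Function.update P i b) i j

/-- `Φ` admits arbitrage by the coalition `C`: there are report tuples `P, Q` agreeing
outside `C` such that the coalition's total reward under `Q` is at least that under `P`
for every outcome, and strictly larger for some outcome. -/
def AdmitsArbitrageBy {m n : ℕ} (Φ : (Fin m → Fin n → ℝ) → Fin m → Fin n → ℝ)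
    (C : Finset (Fin m)) : Prop :=
  ∃ P Q : Fin m → Fin n → ℝ, IsSimplexTuple P ∧ IsSimplexTuple Q ∧
    (∀ i ∉ C, P i = Q i) ∧
    (∀ j, ∑ i ∈ C, Φ P i j ≤ ∑ i ∈ C, Φ Q i j) ∧
    (∃ j, ∑ i ∈ C, Φ P i j < ∑ i ∈ C, Φ Q i j)

/-- `Φ` admits arbitrage if some coalition admits arbitrage. -/
def AdmitsArbitrage {m n : ℕ} (Φ : (Fin m → Fin n → ℝ) → Fin m → Fin n → ℝ) : Prop :=
  ∃ C : Finset (Fin m), AdmitsArbitrageBy Φ C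

/-- `Φ` is arbitrage-free if it admits no arbitrage. -/
def ArbitrageFree {m n : ℕ} (Φ : (Fin m → Fin n → ℝ) → Fin m → Fin n → ℝ) : Prop :=
  ¬ AdmitsArbitrage Φ

theorem squ_two_zero {p : Fin 2 → ℝ} (hp : p 0 + p 1 = 1) : squ p 0 = 1 - 2 * (1 - p 0) ^ 2 := by
  have hc : ({0}ᶜ : Finset (Fin 2)) = {1} := by decide
  have h1 : p 1 = 1 - p 0 := by linarith
  rw [squ, hc, sum_singleton, h1]
  ring

theorem squ_two_one {p : Fin 2 → ℝ} (hp : p 0 + p 1 = 1) : squ p 1 = 1 - 2 * p 0 ^ 2 := by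
  have hc : ({1}ᶜ : Finset (Fin 2)) = {0} := by decide
  have h1 : p 1 = 1 - p 0 := by linarith
  rw [squ, hc, sum_singleton, h1]
  ring

theorem avgExcept_update_self {m n : ℕ} (P : Fin m → Fin n → ℝ) (i : Fin m) (x : Fin n → ℝ) :
    avgExcept (Function.update P i x) i = avgExcept P i := by
  funext j
  unfold avgExcept
  congr 1
  refine sum_congr rfl fun k hk => ?_
  have hki : k ≠ i := by simpa using hk
  rw [Function.update_of_ne hki]

theorem avgExcept_eq {m n : ℕ} (P : Fin m → Fin n → ℝ) (i : Fin m) (j : Fin n) :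
    avgExcept P i j = (∑ k, P k j - P i j) / ((m : ℝ) - 1) := by
  have h := sum_compl_add_sum ({i} : Finset (Fin m)) (fun k => P k j)
  rw [sum_singleton] at h
  rw [avgExcept, ← h]
  ring

theorem IsSimplexTuple.add_eq_one {m : ℕ} {P : Fin m → Fin 2 → ℝ} (hP : IsSimplexTuple P)
    (k : Fin m) : P k 0 + P k 1 = 1 := by
  simpa [Fin.sum_univ_two] using (hP k).2

theorem IsSimplexTuple.avgExcept_add_eq_one {m : ℕ} (hm : 2 ≤ m) {P : Fin m → Fin 2 → ℝ}
    (hP : IsSimplexTuple P) (i : Fin m) : avgExcept P i 0 + avgExcept P i 1 = 1 := by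
  have hm' : (2 : ℝ) ≤ m := by exact_mod_cast hm
  have hN : (m : ℝ) - 1 ≠ 0 := by linarith
  have hsum : ∑ k, P k 0 + ∑ k, P k 1 = m := by
    rw [← sum_add_distrib, sum_congr rfl fun k _ => hP.add_eq_one k]
    simp
  rw [avgExcept_eq, avgExcept_eq, ← add_div, div_eq_one_iff_eq hN]
  linarith [hP.add_eq_one i]

/-- With two outcomes, the total reward of a coalition under outcome `1` depends only on the
sum of the coalition's reports and the sum of all reports. -/
theorem sum_piAlpha_one {m : ℕ} (hm : 2 ≤ m) (α : ℝ) {P : Fin m → Fin 2 → ℝ}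
    (hP : IsSimplexTuple P) (C : Finset (Fin m)) :
    ∑ i ∈ C, piAlpha α P i 1 =
      #C * (1 - ((m : ℝ) - 1) ^ 2 + 2 * (∑ k, P k 0) ^ 2 + α
        - α / ((m : ℝ) - 1) * ∑ k, P k 0)
      + (α / ((m : ℝ) - 1) - 4 * ∑ k, P k 0) * ∑ i ∈ C, P i 0 := by
  have hm' : (2 : ℝ) ≤ m := by exact_mod_cast hm
  have hN : (m : ℝ) - 1 ≠ 0 := by linarith
  rw [mul_sum C, ← nsmul_eq_mul, ← sum_const, ← sum_add_distrib]
  refine sum_congr rfl fun i _ => ?_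
  have havg := hP.avgExcept_add_eq_one hm i
  rw [piAlpha, squ_two_one (hP.add_eq_one i), squ_two_one havg, eq_sub_of_add_eq' havg,
    avgExcept_eq]
  field_simp
  ring

/-- With two outcomes, the total reward of a coalition under outcome `0` depends only on the
sum of the coalition's reports and the sum of all reports. -/
theorem sum_piAlpha_zero {m : ℕ} (hm : 2 ≤ m) (α : ℝ) {P : Fin m → Fin 2 → ℝ}
    (hP : IsSimplexTuple P) (C : Finset (Fin m)) :
    ∑ i ∈ C, piAlpha α P i 0 =
      #C * (-1 - ((m : ℝ) - 1) ^ 2 + 2 * ((m : ℝ) - 1 - ∑ k, P k 0) ^ 2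
        + α / ((m : ℝ) - 1) * ∑ k, P k 0)
      + (4 + 4 * ((m : ℝ) - 1 - ∑ k, P k 0) - α / ((m : ℝ) - 1)) * ∑ i ∈ C, P i 0 := by
  have hm' : (2 : ℝ) ≤ m := by exact_mod_cast hm
  have hN : (m : ℝ) - 1 ≠ 0 := by linarith
  rw [mul_sum C, ← nsmul_eq_mul, ← sum_const, ← sum_add_distrib]
  refine sum_congr rfl fun i _ => ?_
  rw [piAlpha, squ_two_zero (hP.add_eq_one i), squ_two_zero (hP.avgExcept_add_eq_one hm i),
    avgExcept_eq]
  field_simp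
  ring

theorem IsSimplexTuple.sum_nonneg {m n : ℕ} {P : Fin m → Fin n → ℝ} (hP : IsSimplexTuple P)
    (C : Finset (Fin m)) (j : Fin n) : 0 ≤ ∑ i ∈ C, P i j :=
  Finset.sum_nonneg fun i _ => (hP i).1 j

theorem IsSimplexTuple.sum_le_card {m n : ℕ} {P : Fin m → Fin n → ℝ} (hP : IsSimplexTuple P)
    (C : Finset (Fin m)) (j : Fin n) : ∑ i ∈ C, P i j ≤ #C := by
  have h := sum_le_card_nsmul C (fun i => P i j) 1 fun i _ => by
    rw [← (hP i).2]
    exact single_le_sum (fun l _ => (hP i).1 l) (mem_univ j)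
  simpa using h

/-- If a quantity moves from `X` to `Y` and two rewards change by `(Y - X) * A` and
`(Y - X) * B` with `A` and `B` of strictly opposite signs, then it cannot be that neither
reward decreases, unless `X = Y`. -/
theorem eq_of_mul_nonneg_of_mul_neg {d A B : ℝ} (hAB : A * B < 0) (hA : 0 ≤ d * A)
    (hB : 0 ≤ d * B) : d = 0 := by
  by_contra hd
  have h := mul_nonneg hA hB
  nlinarith [mul_neg_of_pos_of_neg (sq_pos_of_ne_zero hd) hAB]

/-- The marginal total rewards of a coalition of size `c ≥ 2` under the two outcomes have
opposite signs; `X` and `Y` are sums of coalition reports and `F` is the sum of the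
reports outside the coalition. -/
theorem marginal_mul_neg {c N β X Y F : ℝ} (hc : 2 ≤ c) (hX : 0 ≤ X) (hXc : X ≤ c) (hY : 0 ≤ Y)
    (hYc : Y ≤ c) (hF : 0 ≤ F) (hFc : F ≤ N + 1 - c) (hβ : β < 0 ∨ 4 * N ≤ β) :
    (2 * (c - 2) * (X + Y) + 4 * (c - 1) * F - β * (c - 1)) *
      (2 * (c - 2) * (X + Y) + 4 * (c - 1) * F + 4 - 4 * N * (c - 1) + β * (c - 1)) < 0 := by
  have h1 : 0 ≤ (c - 2) * (X + Y) := mul_nonneg (by linarith) (by linarith)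
  have h2 : (c - 2) * (X + Y) ≤ (c - 2) * (2 * c) :=
    mul_le_mul_of_nonneg_left (by linarith) (by linarith)
  have h3 : 0 ≤ (c - 1) * F := mul_nonneg (by linarith) hF
  have h4 : (c - 1) * F ≤ (c - 1) * (N + 1 - c) := mul_le_mul_of_nonneg_left hFc (by linarith)
  rcases hβ with hβ | hβ
  · have h5 : β * (c - 1) < 0 := mul_neg_of_neg_of_pos hβ (by linarith)
    exact mul_neg_of_pos_of_neg (by linarith) (by linarith)
  · have h5 : 4 * N * (c - 1) ≤ β * (c - 1) := mul_le_mul_of_nonneg_right hβ (by linarith)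
    exact mul_neg_of_neg_of_pos (by linarith) (by linarith)

theorem strictlyProper_piAlpha_two {m : ℕ} (α : ℝ) :
    StrictlyProper (piAlpha (m := m) (n := 2) α) := by
  intro i P _ b hb x hx hxb
  have hb1 : b 0 + b 1 = 1 := by simpa [Fin.sum_univ_two] using hb.2
  have hx1 : x 0 + x 1 = 1 := by simpa [Fin.sum_univ_two] using hx.2
  have hne : x 0 - b 0 ≠ 0 := by
    intro h
    refine hxb (funext fun j => ?_)
    fin_cases j
    · exact sub_eq_zero.mp h
    · show x 1 = b 1
      linarith
  simp only [Fin.sum_univ_two, piAlpha, avgExcept_update_self, Function.update_self,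
    squ_two_zero hb1, squ_two_zero hx1, squ_two_one hb1, squ_two_one hx1]
  rw [eq_sub_of_add_eq' hb1]
  nlinarith [sq_pos_of_ne_zero hne]

theorem arbitrageFree_piAlpha_two {m : ℕ} (hm : 2 ≤ m) {α : ℝ}
    (hα : α < 0 ∨ 4 * ((m : ℝ) - 1) ^ 2 ≤ α) :
    ArbitrageFree (piAlpha (m := m) (n := 2) α) := by
  rintro ⟨C, P, Q, hP, hQ, hPQ, hle, j, hlt⟩
  have hm' : (2 : ℝ) ≤ m := by exact_mod_cast hm
  have hN : 0 < (m : ℝ) - 1 := by linarith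
  have hF : ∑ i ∈ Cᶜ, P i 0 = ∑ i ∈ Cᶜ, Q i 0 :=
    sum_congr rfl fun i hi => by rw [hPQ i (mem_compl.mp hi)]
  have hβ : α / ((m : ℝ) - 1) < 0 ∨ 4 * ((m : ℝ) - 1) ≤ α / ((m : ℝ) - 1) := by
    refine hα.imp (fun h => div_neg_of_neg_of_pos h hN) fun h => ?_
    rw [le_div_iff₀ hN]
    linarith
  have hX := hP.sum_nonneg C 0
  have hXc := hP.sum_le_card C 0
  have hY := hQ.sum_nonneg C 0
  have hYc := hQ.sum_le_card C 0
  have hF0 := hP.sum_nonneg Cᶜ 0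
  have hFc := hP.sum_le_card Cᶜ 0
  have hcard : (#C : ℝ) + #Cᶜ = m := by
    exact_mod_cast (card_add_card_compl C).trans (Fintype.card_fin m)
  have hTP := sum_add_sum_compl C fun i => P i 0
  have hTQ := sum_add_sum_compl C fun i => Q i 0
  have h0 := hle 0
  have h1 := hle 1
  have heq : ∑ i ∈ C, Q i 0 - ∑ i ∈ C, P i 0 = 0 := by
    rw [sum_piAlpha_zero hm α hP, sum_piAlpha_zero hm α hQ, ← hTP, ← hTQ, ← hF] at h0
    rw [sum_piAlpha_one hm α hP, sum_piAlpha_one hm α hQ, ← hTP, ← hTQ, ← hF] at h1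
    generalize ∑ i ∈ C, P i 0 = X at *
    generalize ∑ i ∈ C, Q i 0 = Y at *
    generalize ∑ i ∈ Cᶜ, P i 0 = F at *
    generalize α / ((m : ℝ) - 1) = β at *
    rcases Nat.lt_or_ge #C 2 with hC | hC
    · interval_cases hc : #C
      · norm_num at hXc hYc
        linarith
      · norm_num at h0 h1 hXc hYc
        nlinarith
    · have hC' : (2 : ℝ) ≤ #C := by exact_mod_cast hC
      refine eq_of_mul_nonneg_of_mul_neg
        (marginal_mul_neg hC' hX hXc hY hYc hF0 (N := (m : ℝ) - 1) (by linarith) hβ) ?_ ?_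
      · linarith
      · linarith
  have hT : ∑ i, P i 0 = ∑ i, Q i 0 := by linarith
  have hC : ∑ i ∈ C, P i 0 = ∑ i ∈ C, Q i 0 := by linarith
  refine hlt.ne ?_
  fin_cases j
  · exact (sum_piAlpha_zero hm α hP C).trans (hT ▸ hC ▸ (sum_piAlpha_zero hm α hQ C).symm)
  · exact (sum_piAlpha_one hm α hP C).trans (hT ▸ hC ▸ (sum_piAlpha_one hm α hQ C).symm)

/-- **Theorem 1 for `n = 2` outcomes.** For `m ≥ 2` experts, two outcomes, and `α < 0` or
`α ≥ 4(m-1)²`, the contract function `Π^α` is strictly proper and arbitrage-free. -/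
theorem piAlpha_strictlyProper_arbitrageFree_two_outcomes (m : ℕ) (hm : 2 ≤ m) (α : ℝ)
    (hα : α < 0 ∨ 4 * ((m : ℝ) - 1) ^ 2 ≤ α) :
    StrictlyProper (piAlpha (m := m) (n := 2) α) ∧
      ArbitrageFree (piAlpha (m := m) (n := 2) α) := by
  exact ⟨strictlyProper_piAlpha_two α, arbitrageFree_piAlpha_two hm hα⟩
end

section
/- For any n ≥ 2 and any reports p_1, …, p_m ∈ Δ_n with mean p̄ = (1/m) Σ_i p_i, for every outcome j ∈ [n]: m · s_qu(p̄; j) − Σ_{i=1}^m s_qu(p_i; j) = Σ_{i=1}^m ‖p_i − p̄‖₂² ≥ 0, with strict inequality whenever the p_i are not all equal. Consequently, the contract function that rewards each of m ≥ 2 experts independently with the quadratic scoring rule (Π_i(P; j) = s_qu(p_i; j)) admits arbitrage whenever it is possible for experts' reports to disagree: the coalition of all experts can deviate to each report the mean p̄ and strictly increase their total reward under every outcome. -/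
open Finset

theorem squ_eq_two_mul_sub_sum_sq {n : ℕ} (p : Fin n → ℝ) (j : Fin n) :
    squ p j = 2 * p j - ∑ l, p l ^ 2 := by
  rw [squ, Fintype.sum_eq_add_sum_compl j]
  ring

theorem sum_sq_sub_mean {m : ℕ} (hm : m ≠ 0) (a : Fin m → ℝ) :
    ∑ i, (a i - (1 / (m : ℝ)) * ∑ k, a k) ^ 2
      = ∑ i, a i ^ 2 - m * ((1 / (m : ℝ)) * ∑ k, a k) ^ 2 := by
  have hm' : (m : ℝ) ≠ 0 := Nat.cast_ne_zero.mpr hm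
  simp_rw [sub_sq, sum_add_distrib, sum_sub_distrib, ← sum_mul, ← mul_sum]
  simp only [sum_const, card_univ, Fintype.card_fin, nsmul_eq_mul]
  field_simp
  ring

theorem mul_squ_mean_sub_sum_squ {m n : ℕ} (hm : m ≠ 0) (P : Fin m → Fin n → ℝ) (j : Fin n) :
    (m : ℝ) * squ (fun l => (1 / (m : ℝ)) * ∑ i, P i l) j - ∑ i, squ (P i) j
      = ∑ i, ∑ l, (P i l - (1 / (m : ℝ)) * ∑ k, P k l) ^ 2 := by
  have hm' : (m : ℝ) ≠ 0 := Nat.cast_ne_zero.mpr hm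
  have hmean : (m : ℝ) * ((1 / (m : ℝ)) * ∑ i, P i j) = ∑ i, P i j := by
    field_simp
  rw [sum_comm]
  simp_rw [sum_sq_sub_mean hm, squ_eq_two_mul_sub_sum_sq, sum_sub_distrib, ← mul_sum]
  rw [sum_comm (f := fun i l => P i l ^ 2)]
  linear_combination 2 * hmean

theorem sum_sq_sub_pos_of_not_all_eq {m n : ℕ} (P : Fin m → Fin n → ℝ) (q : Fin n → ℝ)
    (hP : ¬ ∀ i i' : Fin m, P i = P i') :
    0 < ∑ i, ∑ l, (P i l - q l) ^ 2 := by
  refine (sum_nonneg fun i _ => sum_nonneg fun l _ => sq_nonneg _).lt_of_ne' fun h => hP ?_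
  have heq : ∀ i, P i = q := fun i => by
    ext l
    rw [sum_eq_zero_iff_of_nonneg fun i _ => sum_nonneg fun l _ => sq_nonneg _] at h
    have hi := h i (mem_univ i)
    rw [sum_eq_zero_iff_of_nonneg fun l _ => sq_nonneg _] at hi
    exact sub_eq_zero.mp (pow_eq_zero_iff two_ne_zero |>.mp (hi l (mem_univ l)))
  exact fun i i' => (heq i).trans (heq i').symm

theorem sum_squ_lt_sum_squ_mean {m n : ℕ} (hm : m ≠ 0) (P : Fin m → Fin n → ℝ)
    (hP : ¬ ∀ i i' : Fin m, P i = P i') (j : Fin n) :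
    ∑ i, squ (P i) j < ∑ _i : Fin m, squ (fun l => (1 / (m : ℝ)) * ∑ k, P k l) j := by
  have hpos := sum_sq_sub_pos_of_not_all_eq P (fun l => (1 / (m : ℝ)) * ∑ k, P k l) hP
  rw [← mul_squ_mean_sub_sum_squ hm P j] at hpos
  rw [sum_const, card_univ, Fintype.card_fin, nsmul_eq_mul]
  exact sub_pos.mp hpos

theorem mean_mem_stdSimplex {m n : ℕ} (hm : m ≠ 0) {P : Fin m → Fin n → ℝ}
    (hP : IsSimplexTuple P) :
    (fun l => (1 / (m : ℝ)) * ∑ k, P k l) ∈ stdSimplex ℝ (Fin n) := by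
  have hm' : (m : ℝ) ≠ 0 := Nat.cast_ne_zero.mpr hm
  refine ⟨fun l => mul_nonneg (by positivity) (sum_nonneg fun k _ => (hP k).1 l), ?_⟩
  rw [← mul_sum, sum_comm, sum_congr rfl fun k _ => (hP k).2]
  simp [hm']

theorem exists_isSimplexTuple_not_all_eq {m n : ℕ} (hm : 2 ≤ m) (hn : 2 ≤ n) :
    ∃ P : Fin m → Fin n → ℝ, IsSimplexTuple P ∧ ¬ ∀ i i' : Fin m, P i = P i' := by
  have : Nontrivial (Fin m) := Fin.nontrivial_iff_two_le.mpr hm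
  have : Nontrivial (Fin n) := Fin.nontrivial_iff_two_le.mpr hn
  obtain ⟨i, i', hi⟩ := exists_pair_ne (Fin m)
  obtain ⟨j, j', hj⟩ := exists_pair_ne (Fin n)
  refine ⟨fun k => Pi.single (if k = i then j else j') 1,
    fun k => single_mem_stdSimplex ℝ _, fun h => ?_⟩
  simpa [hi.symm, Pi.single_apply, hj] using congrFun (h i i') j

/-- For reports `p₁, …, p_m ∈ Δ_n` with mean `p̄`, for every outcome `j`:
`m · s_qu(p̄; j) - ∑_i s_qu(p_i; j) = ∑_i ‖p_i - p̄‖₂² ≥ 0`, strictly whenever the `p_i` are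
not all equal. Consequently (for `m ≥ 2`, `n ≥ 2`), the contract function rewarding each
expert independently with the quadratic scoring rule admits arbitrage: the coalition of all
experts can deviate to all report the mean and strictly increase their total reward under
every outcome. -/
theorem quadratic_contract_admits_arbitrage (m n : ℕ) (hm : 2 ≤ m) (hn : 2 ≤ n) :
    (∀ P : Fin m → Fin n → ℝ, IsSimplexTuple P → ∀ j : Fin n,
      ((m : ℝ) * squ (fun l => (1 / (m : ℝ)) * ∑ i, P i l) j - ∑ i, squ (P i) j
          = ∑ i, ∑ l, (P i l - (1 / (m : ℝ)) * ∑ k, P k l) ^ 2) ∧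
      (0 ≤ ∑ i, ∑ l, (P i l - (1 / (m : ℝ)) * ∑ k, P k l) ^ 2) ∧
      ((¬ ∀ i i' : Fin m, P i = P i') →
        0 < ∑ i, ∑ l, (P i l - (1 / (m : ℝ)) * ∑ k, P k l) ^ 2)) ∧
    (∀ P : Fin m → Fin n → ℝ, IsSimplexTuple P → (¬ ∀ i i' : Fin m, P i = P i') →
      ∀ j : Fin n, ∑ i, squ (P i) j < ∑ i : Fin m, squ (fun l => (1 / (m : ℝ)) * ∑ k, P k l) j) ∧
    AdmitsArbitrage (fun (P : Fin m → Fin n → ℝ) (i : Fin m) (j : Fin n) => squ (P i) j) := by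
  have hm0 : m ≠ 0 := by omega
  refine ⟨fun P _ j => ⟨mul_squ_mean_sub_sum_squ hm0 P j,
    sum_nonneg fun i _ => sum_nonneg fun l _ => sq_nonneg _,
    sum_sq_sub_pos_of_not_all_eq P _⟩,
    fun P _ hP j => sum_squ_lt_sum_squ_mean hm0 P hP j, ?_⟩
  obtain ⟨P, hP, hne⟩ := exists_isSimplexTuple_not_all_eq hm hn
  have hlt := sum_squ_lt_sum_squ_mean hm0 P hne
  exact ⟨univ, P, fun _ l => (1 / (m : ℝ)) * ∑ k, P k l, hP,
    fun _ => mean_mem_stdSimplex hm0 hP, fun i hi => absurd (mem_univ i) hi,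
    fun j => (hlt j).le, ⟨0, by omega⟩, hlt _⟩
end
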